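/- Let G be a perfect graph on n ≥ 1 vertices with greedy stable-set sequence S_1, …, S_k, and for each vertex v let m(v) be the unique index with v ∈ S_{m(v)}. Fix δ with 0 < δ ≤ 1 and define z ∈ ℝ^V by z_v := (δ/n^δ)·|S_{m(v)}|^{δ−1}. Then z belongs to the stable set polytope STAB(Ḡ) of the complement graph Ḡ of G. -/

import Mathlib

/-- A stable (independent) set of a simple graph, as a `Finset` of vertices. -/
def IsStableSet {V : Type*} (G : SimpleGraph V) (S : Finset V) : Prop :=
  ∀ v ∈ S, ∀ w ∈ S, ¬ G.Adj v w

/-- The stable set polytope `STAB(G)`: the convex hull of characteristic vectors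
of stable sets of `G`. -/
noncomputable def STAB {V : Type*} [Fintype V] [DecidableEq V] (G : SimpleGraph V) :
    Set (V → ℝ) :=
  convexHull ℝ {x | ∃ S : Finset V, IsStableSet G S ∧
    x = fun v => if v ∈ S then (1 : ℝ) else 0}

/-- A graph is perfect if every induced subgraph has clique number equal to
chromatic number. -/
def IsPerfect {V : Type*} (G : SimpleGraph V) : Prop :=
  ∀ U : Set V, ((G.induce U).cliqueNum : ℕ∞) = (G.induce U).chromaticNumber

/-- `S 0, S 1, …, S (k-1)` is a greedy stable-set sequence of `G`: the `S i` are
pairwise disjoint stable sets partitioning the vertex set, and each `S i` is a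
maximum-cardinality stable set among those avoiding `S 0 ∪ ⋯ ∪ S (i-1)`. -/
def IsGreedySeq {V : Type*} [Fintype V] (G : SimpleGraph V) {k : ℕ}
    (S : Fin k → Finset V) : Prop :=
  (∀ i, IsStableSet G (S i)) ∧
  (∀ i j, i ≠ j → Disjoint (S i) (S j)) ∧
  (∀ v : V, ∃ i, v ∈ S i) ∧
  (∀ i : Fin k, ∀ T : Finset V, IsStableSet G T →
    (∀ v ∈ T, ∀ j, j < i → v ∉ S j) → T.card ≤ (S i).card)

section StableCover

variable {V : Type*} {G : SimpleGraph V}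

lemma IsStableSet.mono {S T : Finset V} (hT : IsStableSet G T) (h : S ⊆ T) :
    IsStableSet G S :=
  fun v hv w hw => hT v (h hv) w (h hw)

variable [DecidableEq V]

lemma IsStableSet.card_inter_le_one {K T : Finset V} (hK : IsStableSet Gᶜ K)
    (hT : IsStableSet G T) : (K ∩ T).card ≤ 1 := by
  refine Finset.card_le_one.2 fun a ha b hb => ?_
  rw [Finset.mem_inter] at ha hb
  by_contra hab
  exact hK a ha.1 b hb.1 ⟨hab, hT a ha.2 b hb.2⟩

/-- A clique meets each member of a family of stable sets at most once. -/
lemma sum_countP_mem_le_card {K : Finset V} (hK : IsStableSet Gᶜ K)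
    (L : Multiset (Finset V)) (hL : ∀ T ∈ L, IsStableSet G T) :
    ∑ v ∈ K, L.countP (fun T => v ∈ T) ≤ L.card := by
  induction L using Multiset.induction_on with
  | empty => simp
  | cons T L ih =>
    have h1 := ih fun T' h => hL T' (Multiset.mem_cons_of_mem h)
    have h2 := hK.card_inter_le_one (hL T (Multiset.mem_cons_self T L))
    simp only [Multiset.countP_cons, Finset.sum_add_distrib, Multiset.card_cons,
      Finset.sum_boole, Finset.filter_mem_eq_inter, Nat.cast_id]
    lia

variable [Fintype V]

/-- In a perfect graph, any bound on the size of the cliques inside `U` bounds the number of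
stable sets needed to cover `U`. -/
lemma IsPerfect.exists_stable_cover_of_finset (hG : IsPerfect G) (U : Finset V) (k : ℕ)
    (hk : ∀ K ⊆ U, IsStableSet Gᶜ K → K.card ≤ k) :
    ∃ L : Multiset (Finset V), L.card = k ∧ (∀ T ∈ L, IsStableSet G T) ∧
      ∀ v ∈ U, 1 ≤ L.countP (fun T => v ∈ T) := by
  classical
  have hω : (G.induce (U : Set V)).cliqueNum ≤ k := by
    obtain ⟨s, hs⟩ := (G.induce (U : Set V)).exists_isNClique_cliqueNum
    rw [← hs.card_eq, ← Finset.card_map (Function.Embedding.subtype _)]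
    refine hk _ ?_ ?_
    · intro v hv
      obtain ⟨w, -, rfl⟩ := Finset.mem_map.1 hv
      exact w.2
    · intro v hv w hw hvw
      obtain ⟨v, hvs, rfl⟩ := Finset.mem_map.1 hv
      obtain ⟨w, hws, rfl⟩ := Finset.mem_map.1 hw
      exact hvw.2 (hs.isClique hvs hws fun h => hvw.1 (by rw [h]))
  have hχ : (G.induce (U : Set V)).Colorable k := by
    rw [← SimpleGraph.chromaticNumber_le_iff_colorable, ← hG]
    exact_mod_cast hω
  obtain ⟨C⟩ := hχ
  let color (i : Fin k) : Finset V := {v | ∃ h : v ∈ (U : Set V), C ⟨v, h⟩ = i}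
  refine ⟨Finset.univ.val.map color, by simp, ?_, ?_⟩
  · intro T hT v hv w hw hvw
    obtain ⟨i, -, rfl⟩ := Multiset.mem_map.1 hT
    obtain ⟨h1, h2⟩ := (Finset.mem_filter.1 hv).2
    obtain ⟨h3, h4⟩ := (Finset.mem_filter.1 hw).2
    have hadj : (G.induce (U : Set V)).Adj ⟨v, h1⟩ ⟨w, h3⟩ := hvw
    exact C.valid hadj (h2.trans h4.symm)
  · intro v hv
    refine Multiset.countP_pos.2 ⟨color (C ⟨v, hv⟩), ?_, ?_⟩
    · exact Multiset.mem_map_of_mem _ (Finset.mem_univ_val _)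
    · exact Finset.mem_filter.2 ⟨Finset.mem_univ _, hv, rfl⟩

/-- Weighted min-max relation for perfect graphs (Lovász's replication lemma): if all cliques
have weight at most `k`, then `k` stable sets cover each vertex as often as its weight. -/
lemma IsPerfect.exists_stable_cover (hG : IsPerfect G) (c : V → ℕ) (k : ℕ)
    (hk : ∀ K, IsStableSet Gᶜ K → ∑ v ∈ K, c v ≤ k) :
    ∃ L : Multiset (Finset V), L.card = k ∧ (∀ T ∈ L, IsStableSet G T) ∧
      ∀ v, c v ≤ L.countP (fun T => v ∈ T) := by
  induction hs : ∑ v, c v using Nat.strong_induction_on generalizing c k with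
  | _ s ih =>
  subst hs
  by_cases hc : ∀ v, c v ≤ 1
  · obtain ⟨L, hL, hst, hcov⟩ := hG.exists_stable_cover_of_finset {v | c v ≠ 0} k (by
      intro K hKU hK
      refine le_trans ?_ (hk K hK)
      rw [Finset.card_eq_sum_ones]
      exact Finset.sum_le_sum fun v hv =>
        Nat.one_le_iff_ne_zero.2 (Finset.mem_filter.1 (hKU hv)).2)
    refine ⟨L, hL, hst, fun v => ?_⟩
    by_cases h0 : c v = 0
    · simp [h0]
    · exact (hc v).trans (hcov v (by simp [h0]))
  · push Not at hc
    obtain ⟨v, hv⟩ := hc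
    let c' : V → ℕ := fun w => if w = v then c v - 1 else c w
    have hc'le : ∀ w, c' w ≤ c w := by intro w; dsimp [c']; grind
    have hc'v : c' v < c v := by simp [c']; lia
    have hsum : ∑ w, c' w < ∑ w, c w :=
      Finset.sum_lt_sum (fun w _ => hc'le w) ⟨v, Finset.mem_univ v, hc'v⟩
    obtain ⟨L, hL, hst, hcov⟩ := ih _ hsum c' k
      (fun K hK => (Finset.sum_le_sum fun w _ => hc'le w).trans (hk K hK)) rfl
    have hpos : 0 < L.countP (fun T => v ∈ T) :=
      lt_of_lt_of_le (by simp [c']; lia) (hcov v)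
    obtain ⟨T, hTL, hvT⟩ := Multiset.countP_pos.1 hpos
    obtain ⟨L', rfl⟩ := Multiset.exists_cons_of_mem hTL
    rw [Multiset.card_cons] at hL
    have hst' : ∀ T ∈ L', IsStableSet G T := fun T h => hst T (Multiset.mem_cons_of_mem h)
    simp only [Multiset.countP_cons] at hcov
    let c'' : V → ℕ := fun w => if w ∈ T ∧ w ≠ v then c' w - 1 else c' w
    have hc''le : ∀ w, c'' w ≤ c' w := by intro w; dsimp [c'']; grind
    obtain ⟨M, hM, hMst, hMcov⟩ := ih _
      ((Finset.sum_le_sum fun w _ => hc''le w).trans_lt hsum) c'' L'.card (by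
        intro K hK
        by_cases hvK : v ∈ K
        · have h1 : ∑ w ∈ K, c'' w < ∑ w ∈ K, c w :=
            Finset.sum_lt_sum (fun w _ => (hc''le w).trans (hc'le w))
              ⟨v, hvK, (hc''le v).trans_lt hc'v⟩
          have h2 := hk K hK
          lia
        · refine le_trans (Finset.sum_le_sum fun w hw => ?_)
            (sum_countP_mem_le_card hK L' hst')
          have hwv : w ≠ v := fun h => hvK (h ▸ hw)
          have := hcov w
          dsimp only [c'']
          grind) rfl
    refine ⟨T ::ₘ M, by rw [Multiset.card_cons, hM, hL], ?_, fun w => ?_⟩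
    · intro T' hT'
      rcases Multiset.mem_cons.1 hT' with rfl | h
      · exact hst _ hTL
      · exact hMst _ h
    · have := hMcov w
      rw [Multiset.countP_cons]
      dsimp only [c'', c'] at this
      grind

lemma sum_countP_mul_le_card (z : V → ℝ) (hz : ∀ T, IsStableSet G T → ∑ v ∈ T, z v ≤ 1)
    (L : Multiset (Finset V)) (hL : ∀ T ∈ L, IsStableSet G T) :
    ∑ v, (L.countP (fun T => v ∈ T) : ℝ) * z v ≤ L.card := by
  induction L using Multiset.induction_on with
  | empty => simp
  | cons T L ih =>
    have h1 := ih fun T' h => hL T' (Multiset.mem_cons_of_mem h)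
    have h2 := hz T (hL T (Multiset.mem_cons_self T L))
    have h3 : ∑ v, ((if v ∈ T then 1 else 0 : ℕ) : ℝ) * z v = ∑ v ∈ T, z v := by simp
    simp only [Multiset.countP_cons, Nat.cast_add, add_mul, Finset.sum_add_distrib,
      Multiset.card_cons, h3]
    push_cast
    linarith

/-- For a perfect graph, the stable set constraints and nonnegativity describe the clique
polytope. -/
lemma IsPerfect.mem_STAB_compl (hG : IsPerfect G) (z : V → ℝ) (hz0 : ∀ v, 0 ≤ z v)
    (hz : ∀ T, IsStableSet G T → ∑ v ∈ T, z v ≤ 1) : z ∈ STAB Gᶜ := by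
  by_contra hmem
  have hfin : {x : V → ℝ | ∃ S : Finset V, IsStableSet Gᶜ S ∧
      x = fun v => if v ∈ S then (1 : ℝ) else 0}.Finite :=
    (Set.finite_range fun S : Finset V => fun v => if v ∈ S then (1 : ℝ) else 0).subset
      (by rintro x ⟨S, -, rfl⟩; exact ⟨S, rfl⟩)
  obtain ⟨f, u, hfu, huz⟩ := geometric_hahn_banach_closed_point (convex_convexHull ℝ _)
    (hfin.isClosed_convexHull ℝ) hmem
  let c : V → ℝ := fun v => f (Pi.single v 1)
  have hf (x : V → ℝ) : f x = ∑ v, c v * x v := by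
    conv_lhs => rw [pi_eq_sum_univ' x]
    simp only [map_sum, map_smul, smul_eq_mul, c]
    refine Finset.sum_congr rfl fun v _ => ?_
    rw [mul_comm]
  have hclique (K : Finset V) (hK : IsStableSet Gᶜ K) : ∑ v ∈ K, c v < u := by
    have := hfu _ (subset_convexHull ℝ _ ⟨K, hK, rfl⟩)
    simpa [hf] using this
  have hclique' (K : Finset V) (hK : IsStableSet Gᶜ K) : ∑ v ∈ K, max (c v) 0 < u := by
    have := hclique _ (hK.mono (Finset.filter_subset (fun v => 0 ≤ c v) K))
    rw [Finset.sum_filter] at this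
    convert this using 2 with v
    grind
  have hu : 0 < u := by simpa using hclique ∅ (by simp [IsStableSet])
  have hcz : u < ∑ v, max (c v) 0 * z v := by
    rw [hf] at huz
    exact huz.trans_le (Finset.sum_le_sum fun v _ =>
      mul_le_mul_of_nonneg_right (le_max_left _ _) (hz0 v))
  have hscaled (N : ℕ) : N * ∑ v, max (c v) 0 * z v ≤ N * u + Fintype.card V := by
    let d : V → ℕ := fun v => ⌈N * max (c v) 0⌉₊
    obtain ⟨L, hL, hst, hcov⟩ := hG.exists_stable_cover d ⌊N * u + Fintype.card V⌋₊ (by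
      intro K hK
      refine Nat.le_floor ?_
      have h1 : ∀ v ∈ K, (d v : ℝ) ≤ N * max (c v) 0 + 1 := fun v _ =>
        (Nat.ceil_lt_add_one (by positivity)).le
      have h2 := Finset.sum_le_sum h1
      rw [Finset.sum_add_distrib, ← Finset.mul_sum] at h2
      have h3 := mul_le_mul_of_nonneg_left (hclique' K hK).le (Nat.cast_nonneg (α := ℝ) N)
      have h4 : (K.card : ℝ) ≤ Fintype.card V := by exact_mod_cast K.card_le_univ
      simp only [Finset.sum_const, nsmul_eq_mul, mul_one] at h2
      push_cast
      linarith)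
    have h5 := sum_countP_mul_le_card z hz L hst
    rw [hL] at h5
    refine le_trans ?_ (h5.trans (Nat.floor_le (by positivity)))
    rw [Finset.mul_sum]
    refine Finset.sum_le_sum fun v _ => ?_
    rw [← mul_assoc]
    exact mul_le_mul_of_nonneg_right
      ((Nat.le_ceil _).trans (by exact_mod_cast hcov v)) (hz0 v)
  obtain ⟨N, hN⟩ := exists_nat_gt
    ((Fintype.card V : ℝ) / (∑ v, max (c v) 0 * z v - u))
  rw [div_lt_iff₀ (by linarith)] at hN
  have := hscaled N
  linarith

end StableCover

lemma mul_rpow_sub_one_add_rpow_le {δ : ℝ} (hδ0 : 0 ≤ δ) (hδ1 : δ ≤ 1) (t : ℕ) :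
    δ * ((t + 1 : ℕ) : ℝ) ^ (δ - 1) + (t : ℝ) ^ δ ≤ ((t + 1 : ℕ) : ℝ) ^ δ := by
  have hpos : (0 : ℝ) < ((t + 1 : ℕ) : ℝ) := by positivity
  set x : ℝ := ((t + 1 : ℕ) : ℝ) with hx
  have ht : (t : ℝ) = x * (1 + -(1 / x)) := by
    field_simp
    rw [hx]; push_cast; ring
  have hx1 : 1 / x ≤ 1 := by
    rw [div_le_one hpos, hx]; push_cast; linarith [Nat.cast_nonneg (α := ℝ) t]
  have hB := rpow_one_add_le_one_add_mul_self (s := -(1 / x)) (by linarith) hδ0 hδ1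
  rw [ht, Real.mul_rpow hpos.le (by linarith), Real.rpow_sub_one hpos.ne']
  have := mul_le_mul_of_nonneg_left hB (Real.rpow_nonneg hpos.le δ)
  calc _ ≤ δ * (x ^ δ / x) + x ^ δ * (1 + δ * -(1 / x)) := by gcongr
    _ = x ^ δ := by ring

lemma IsGreedySeq.sum_rpow_le {V : Type*} [Fintype V] [DecidableEq V] {G : SimpleGraph V}
    {k : ℕ} {S : Fin k → Finset V} (hS : IsGreedySeq G S) {m : V → Fin k}
    (hm : ∀ v, v ∈ S (m v)) {δ : ℝ} (hδ0 : 0 < δ) (hδ1 : δ ≤ 1) (T : Finset V)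
    (hT : IsStableSet G T) :
    ∑ v ∈ T, δ * ((S (m v)).card : ℝ) ^ (δ - 1) ≤ (T.card : ℝ) ^ δ := by
  induction ht : T.card generalizing T with
  | zero => simp [Finset.card_eq_zero.1 ht, Real.zero_rpow hδ0.ne']
  | succ t ih =>
    obtain ⟨v, hv, hmin⟩ := T.exists_min_image m (Finset.card_pos.1 (by lia))
    have hle : T.card ≤ (S (m v)).card := by
      refine hS.2.2.2 (m v) T hT fun w hw j hj hwj => ?_
      have hjm : j ≠ m w := (hj.trans_le (hmin w hw)).ne
      exact Finset.disjoint_left.1 (hS.2.1 j (m w) hjm) hwj (hm w)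
    have h1 := ih (T.erase v) (hT.mono (T.erase_subset v))
      (by rw [Finset.card_erase_of_mem hv, ht]; rfl)
    rw [← Finset.add_sum_erase T _ hv]
    refine le_trans (add_le_add ?_ h1) (mul_rpow_sub_one_add_rpow_le hδ0.le hδ1 t)
    refine mul_le_mul_of_nonneg_left ?_ hδ0.le
    exact Real.rpow_le_rpow_of_nonpos (by positivity) (by exact_mod_cast ht ▸ hle)
      (by linarith)

/-- For a perfect graph `G` with greedy stable-set sequence `S` and `0 < δ ≤ 1`,
the vector `z_v = (δ/n^δ)·|S (m v)|^(δ-1)` lies in the stable set polytope of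
the complement graph `Ḡ`. -/
theorem greedy_z_mem_STAB_compl {V : Type*} [Fintype V] [DecidableEq V]
    (G : SimpleGraph V) (hn : 1 ≤ Fintype.card V) (hG : IsPerfect G)
    {k : ℕ} (S : Fin k → Finset V) (hS : IsGreedySeq G S)
    (m : V → Fin k) (hm : ∀ v, v ∈ S (m v))
    (δ : ℝ) (hδ0 : 0 < δ) (hδ1 : δ ≤ 1)
    (z : V → ℝ)
    (hz : ∀ v, z v = δ / (Fintype.card V : ℝ) ^ δ *
      ((S (m v)).card : ℝ) ^ (δ - 1)) :
    z ∈ STAB Gᶜ := by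
  have hpos : (0 : ℝ) < (Fintype.card V : ℝ) ^ δ :=
    Real.rpow_pos_of_pos (by exact_mod_cast hn) δ
  refine hG.mem_STAB_compl z (fun v => by rw [hz]; positivity) fun T hT => ?_
  have hsum : ∑ v ∈ T, z v =
      (∑ v ∈ T, δ * ((S (m v)).card : ℝ) ^ (δ - 1)) / (Fintype.card V : ℝ) ^ δ := by
    rw [Finset.sum_div]
    exact Finset.sum_congr rfl fun v _ => by rw [hz]; ring
  rw [hsum, div_le_one hpos]
  refine (hS.sum_rpow_le hm hδ0 hδ1 T hT).trans ?_
  exact Real.rpow_le_rpow (by positivity) (by exact_mod_cast T.card_le_univ) hδ0.le
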